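/- Relation between the two weak formulations (Duhamel identity for test functions): let T > 0 and let ψ : [0,T] → H and ψ' : [0,T] → H be such that ψ' is Bochner integrable, ψ(b) − ψ(a) = ∫_a^b ψ'(σ) dσ for all 0 ≤ a ≤ b ≤ T, and ψ(T) = 0. Define φ(σ) = −G(ψ'(T−σ)) + ψ(T−σ) for σ ∈ [0,T]. Then for every t ∈ [0,T], ∫_0^t S(t−σ) φ(σ) dσ = G(ψ(T−t)). -/

import Mathlib

open scoped RealInnerProductSpace
open MeasureTheory

/-- A bounded diagonal operator in a Hilbert basis is given by a convergent series. -/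
theorem HilbertBasis.summable_mul_inner_smul {ι H : Type*} [NormedAddCommGroup H]
    [InnerProductSpace ℝ H] [CompleteSpace H] (φ : HilbertBasis ι ℝ H) {a : ι → ℝ} {C : ℝ}
    (ha : ∀ k, |a k| ≤ C) (u : H) :
    Summable fun k => (a k * ⟪u, φ k⟫) • φ k := by
  have hmem : Memℓp (fun k => a k * ⟪u, φ k⟫) 2 := by
    refine memℓp_gen ?_
    have hs : Summable fun k => C ^ 2 * (⟪u, φ k⟫ * ⟪φ k, u⟫) :=
      (φ.summable_inner_mul_inner u u).mul_left _
    refine Summable.of_nonneg_of_le (fun k => by positivity) (fun k => ?_) hs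
    have h : (a k) ^ 2 ≤ C ^ 2 := sq_le_sq.mpr ((ha k).trans (le_abs_self C))
    rw [real_inner_comm u (φ k)]
    simp only [ENNReal.toReal_ofNat, Real.rpow_ofNat, Real.norm_eq_abs, sq_abs]
    nlinarith [mul_le_mul_of_nonneg_right h (sq_nonneg ⟪u, φ k⟫)]
  exact (φ.hasSum_repr_symm ⟨_, hmem⟩).summable

/-- Coordinates of the image of `u` under a bounded diagonal operator. -/
theorem HilbertBasis.inner_tsum_mul_inner_smul {ι H : Type*} [NormedAddCommGroup H]
    [InnerProductSpace ℝ H] [CompleteSpace H] (φ : HilbertBasis ι ℝ H) {a : ι → ℝ} {C : ℝ}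
    (ha : ∀ k, |a k| ≤ C) (u : H) (j : ι) :
    ⟪∑' k, (a k * ⟪u, φ k⟫) • φ k, φ j⟫ = a j * ⟪u, φ j⟫ := by
  classical
  rw [real_inner_comm]
  have h := (φ.summable_mul_inner_smul ha u).hasSum.mapL (innerSL ℝ (φ j))
  have h' := h.tsum_eq
  rw [tsum_eq_single j] at h'
  · simpa [inner_smul_right, φ.orthonormal.1 j] using h'.symm
  · intro k hk
    simp [φ.orthonormal.2 hk.symm]

/-- A diagonal operator with coefficients bounded by `C` has norm at most `C`. -/
theorem HilbertBasis.norm_tsum_mul_inner_smul_le {ι H : Type*} [NormedAddCommGroup H]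
    [InnerProductSpace ℝ H] [CompleteSpace H] (φ : HilbertBasis ι ℝ H) {a : ι → ℝ} {C : ℝ}
    (hC : 0 ≤ C) (ha : ∀ k, |a k| ≤ C) (u : H) :
    ‖∑' k, (a k * ⟪u, φ k⟫) • φ k‖ ≤ C * ‖u‖ := by
  set v := ∑' k, (a k * ⟪u, φ k⟫) • φ k with hv
  refine le_of_sq_le_sq ?_ (by positivity)
  have hle := hasSum_le (fun k => ?_) (φ.hasSum_inner_mul_inner v v)
    ((φ.hasSum_inner_mul_inner u u).mul_left (C ^ 2))
  · rwa [real_inner_self_eq_norm_sq, real_inner_self_eq_norm_sq, ← mul_pow] at hle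
  · have h : (a k) ^ 2 ≤ C ^ 2 := sq_le_sq.mpr ((ha k).trans (le_abs_self C))
    rw [real_inner_comm u (φ k), real_inner_comm v (φ k), hv, φ.inner_tsum_mul_inner_smul ha]
    nlinarith [mul_le_mul_of_nonneg_right h (sq_nonneg ⟪u, φ k⟫)]

/-- A uniformly bounded measurable family of diagonal operators preserves integrability. -/
theorem HilbertBasis.integrable_tsum_mul_inner_smul {α H : Type*} [MeasurableSpace α]
    {μ : Measure α} [NormedAddCommGroup H] [InnerProductSpace ℝ H] [CompleteSpace H]
    (φ : HilbertBasis ℕ ℝ H) {a : α → ℕ → ℝ} {C : ℝ} (hC : 0 ≤ C)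
    (hmeas : ∀ k, AEStronglyMeasurable (fun x => a x k) μ)
    (ha : ∀ᵐ x ∂μ, ∀ k, |a x k| ≤ C) {f : α → H} (hf : Integrable f μ) :
    Integrable (fun x => ∑' k, (a x k * ⟪f x, φ k⟫) • φ k) μ := by
  refine (hf.norm.const_mul C).mono' ?_ ?_
  · refine aestronglyMeasurable_of_tendsto_ae Filter.atTop
      (f := fun n x => ∑ k ∈ Finset.range n, (a x k * ⟪f x, φ k⟫) • φ k) (fun n => ?_) ?_
    · refine Finset.aestronglyMeasurable_fun_sum _ fun k _ => ?_
      exact ((hmeas k).mul (hf.inner_const (φ k)).aestronglyMeasurable).smul_const _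
    · filter_upwards [ha] with x hx
      exact (φ.summable_mul_inner_smul hx (f x)).hasSum.tendsto_sum_nat
  · filter_upwards [ha] with x hx
    exact φ.norm_tsum_mul_inner_smul_le hC hx (f x)

/-- The scalar Duhamel identity for the primitive of an integrable function. -/
theorem intervalIntegral_exp_mul_add_primitive {h : ℝ → ℝ} {t : ℝ}
    (hh : IntervalIntegrable h volume 0 t) (m : ℝ) :
    ∫ σ in (0:ℝ)..t, Real.exp (-m * (t - σ)) * (h σ + m * ∫ τ in (0:ℝ)..σ, h τ) =
      ∫ σ in (0:ℝ)..t, h σ := by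
  have hderiv (x : ℝ) : HasDerivAt (fun σ => Real.exp (-m * (t - σ)))
      (m * Real.exp (-m * (t - x))) x := by
    have := (((hasDerivAt_id x).const_sub t).const_mul (-m)).exp
    simp only [id] at this
    convert this using 1
    ring
  have hexp : AbsolutelyContinuousOnInterval (fun σ => Real.exp (-m * (t - σ))) 0 t := by
    have h : ContDiff ℝ 1 (fun σ => Real.exp (-m * (t - σ))) := by fun_prop
    exact h.contDiffOn.absolutelyContinuousOnInterval
  have hprim : AbsolutelyContinuousOnInterval (fun σ => ∫ τ in (0:ℝ)..σ, h τ) 0 t :=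
    hh.absolutelyContinuousOnInterval_intervalIntegral (c := 0) (by simp)
  have key := hexp.integral_deriv_mul_eq_sub hprim
  simp only [sub_self, mul_zero, Real.exp_zero, one_mul, intervalIntegral.integral_same,
    sub_zero] at key
  rw [← key]
  refine intervalIntegral.integral_congr_ae ?_
  filter_upwards [hh.ae_hasDerivAt_integral] with x hx hxt
  rw [(hx (Set.uIoc_subset_uIcc hxt) 0 (by simp)).deriv, (hderiv x).deriv]
  ring

/-- **Relation between the two weak formulations (Duhamel identity for test functions).**
If `ψ : [0,T] → H` has Bochner-integrable derivative `ψ'` (in the sense of the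
fundamental theorem of calculus) with `ψ(T) = 0`, and
`φtest(σ) = -G(ψ'(T-σ)) + ψ(T-σ)`, then for every `t ∈ [0,T]`,
`∫_0^t S(t-σ) φtest(σ) dσ = G(ψ(T-t))`. -/
theorem duhamel_identity_for_test_functions
    {H : Type*} [NormedAddCommGroup H] [InnerProductSpace ℝ H] [CompleteSpace H]
    (φ : HilbertBasis ℕ ℝ H) (lam : ℕ → ℝ)
    (hmono : Monotone lam) (hpos : 0 < lam 0)
    (S : ℝ → H → H)
    (hS : ∀ t u, S t u = ∑' k, (Real.exp (-(lam k) * t) * ⟪u, φ k⟫) • φ k)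
    (G : H → H)
    (hG : ∀ f, G f = ∑' k, ((lam k)⁻¹ * ⟪f, φ k⟫) • φ k)
    (T : ℝ) (hT : 0 < T)
    (ψ ψ' : ℝ → H)
    (hψ'_int : IntegrableOn ψ' (Set.Icc 0 T) volume)
    (hftc : ∀ a b : ℝ, 0 ≤ a → a ≤ b → b ≤ T →
      ψ b - ψ a = ∫ σ in a..b, ψ' σ)
    (hψT : ψ T = 0)
    (φtest : ℝ → H)
    (hφtest : ∀ σ, φtest σ = -G (ψ' (T - σ)) + ψ (T - σ))
    (t : ℝ) (ht : t ∈ Set.Icc (0:ℝ) T) :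
    (∫ σ in (0:ℝ)..t, S (t - σ) (φtest σ)) = G (ψ (T - t)) := by
  obtain ⟨ht0, htT⟩ := ht
  have hlam (k : ℕ) : lam 0 ≤ lam k := hmono (Nat.zero_le k)
  have hlam_pos (k : ℕ) : 0 < lam k := hpos.trans_le (hlam k)
  have hinv (k : ℕ) : |(lam k)⁻¹| ≤ (lam 0)⁻¹ := by
    rw [abs_of_pos (inv_pos.mpr (hlam_pos k))]
    exact inv_anti₀ hpos (hlam k)
  have hexp {s : ℝ} (hs : 0 ≤ s) (k : ℕ) : |Real.exp (-(lam k) * s)| ≤ 1 := by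
    rw [Real.abs_exp, Real.exp_le_one_iff]
    nlinarith [hlam_pos k]
  have hψ'_ii : IntervalIntegrable ψ' volume 0 T :=
    (intervalIntegrable_iff_integrableOn_Icc_of_le hT.le).mpr hψ'_int
  have hη_ii : IntervalIntegrable (fun σ => -ψ' (T - σ)) volume 0 t := by
    have h := (hψ'_ii.comp_sub_left T).symm.neg
    simp only [sub_zero, sub_self] at h
    exact h.mono_set (Set.uIcc_subset_uIcc (by simp) (by simp [Set.uIcc_of_le hT.le, ht0, htT]))
  have hψ_eq {σ : ℝ} (hσ : σ ∈ Set.Icc 0 t) :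
      ψ (T - σ) = ∫ τ in (0:ℝ)..σ, -ψ' (T - τ) := by
    have h := hftc (T - σ) T (by linarith [hσ.2]) (by linarith [hσ.1]) le_rfl
    rw [intervalIntegral.integral_neg, intervalIntegral.integral_comp_sub_left ψ' T, sub_zero, ← h,
      hψT]
    simp
  have hψ_ii : IntervalIntegrable (fun σ => ψ (T - σ)) volume 0 t := by
    have hcont : ContinuousOn (fun σ => ∫ τ in (0:ℝ)..σ, -ψ' (T - τ)) (Set.uIcc 0 t) :=
      intervalIntegral.continuousOn_primitive_interval
        (Set.uIcc_of_le ht0 ▸ (intervalIntegrable_iff_integrableOn_Icc_of_le ht0).mp hη_ii)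
    refine (hcont.congr fun σ hσ => ?_).intervalIntegrable
    rw [Set.uIcc_of_le ht0] at hσ
    exact hψ_eq hσ
  have hGneg (f : H) : -G f = G (-f) := by
    simp only [hG, inner_neg_left, mul_neg, neg_smul, tsum_neg]
  have hφ_int : IntegrableOn φtest (Set.Ioc 0 t) volume := by
    have h : IntegrableOn (fun σ => G (-ψ' (T - σ))) (Set.Ioc 0 t) volume := by
      simp only [hG]
      exact φ.integrable_tsum_mul_inner_smul (a := fun _ k => (lam k)⁻¹) (inv_pos.mpr hpos).le
        (fun k => aestronglyMeasurable_const) (.of_forall fun _ => hinv) hη_ii.1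
    have h' := h.add hψ_ii.1
    refine h'.congr (.of_forall fun σ => ?_)
    simp only [hφtest, hGneg, Pi.add_apply]
  have hF_int : IntegrableOn (fun σ => S (t - σ) (φtest σ)) (Set.Ioc 0 t) volume := by
    simp only [hS]
    refine φ.integrable_tsum_mul_inner_smul zero_le_one (fun k => ?_) ?_ hφ_int
    · exact Continuous.aestronglyMeasurable (by fun_prop)
    · filter_upwards [ae_restrict_mem measurableSet_Ioc] with σ hσ
      exact hexp (sub_nonneg.mpr hσ.2)
  have hinner_ii {f : ℝ → H} {s : ℝ} (k : ℕ) (hf : IntervalIntegrable f volume 0 s) :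
      ⟪∫ τ in (0:ℝ)..s, f τ, φ k⟫ = ∫ τ in (0:ℝ)..s, ⟪f τ, φ k⟫ := by
    have h := (innerSL ℝ (φ k)).intervalIntegral_comp_comm hf
    simp only [innerSL_apply_apply] at h
    rw [real_inner_comm, ← h]
    simp only [real_inner_comm]
  have hη_sub {σ : ℝ} (hσ : σ ∈ Set.Icc 0 t) :
      IntervalIntegrable (fun σ => -ψ' (T - σ)) volume 0 σ :=
    hη_ii.mono_set (Set.uIcc_subset_uIcc (by simp) (by rwa [Set.uIcc_of_le ht0]))
  have hcoord (k : ℕ) : ⟪∫ σ in (0:ℝ)..t, S (t - σ) (φtest σ), φ k⟫ = ⟪G (ψ (T - t)), φ k⟫ := by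
    have hh : IntervalIntegrable (fun σ => ⟪-ψ' (T - σ), φ k⟫) volume 0 t :=
      ⟨hη_ii.1.inner_const _, hη_ii.2.inner_const _⟩
    have htmem : t ∈ Set.Icc 0 t := ⟨ht0, le_rfl⟩
    rw [hinner_ii k ((intervalIntegrable_iff_integrableOn_Ioc_of_le ht0).mpr hF_int), hG,
      φ.inner_tsum_mul_inner_smul hinv, hψ_eq htmem, hinner_ii k hη_ii,
      ← intervalIntegral_exp_mul_add_primitive hh (lam k), ← intervalIntegral.integral_const_mul]
    refine intervalIntegral.integral_congr fun σ hσ => ?_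
    rw [Set.uIcc_of_le ht0] at hσ
    have hne := (hlam_pos k).ne'
    simp only [hS]
    rw [φ.inner_tsum_mul_inner_smul (hexp (sub_nonneg.mpr hσ.2)), hφtest, hGneg, inner_add_left,
      hG, φ.inner_tsum_mul_inner_smul hinv, hψ_eq hσ, hinner_ii k (hη_sub hσ)]
    field_simp
  refine φ.repr.injective (lp.ext (funext fun k => ?_))
  rw [φ.repr_apply_apply, φ.repr_apply_apply, real_inner_comm, hcoord k, real_inner_comm]
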